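/- Let F be a skew hyperfield. The following are equivalent: (1) F satisfies strong Pathetic Cancellation; (2) for all a, b ∈ F^× and all x, y ∈ F with x ∈ 1 ⊞ a and y ∈ (−1) ⊞ b, the three inclusions hold: (x ⊞ y) ∩ (a ⊞ b) ⊆ (x·b) ⊞ (−(a·y)), (a ⊞ b) ∩ ((x·b) ⊞ (−(a·y))) ⊆ x ⊞ y, and (x ⊞ y) ∩ ((x·b) ⊞ (−(a·y))) ⊆ a ⊞ b; (3) for all a, b ∈ F^× and all x, y ∈ F with x ∈ 1 ⊞ a and y ∈ (−1) ⊞ b, one has (x ⊞ y) ∩ (a ⊞ b) = (x ⊞ y) ∩ ((x·b) ⊞ (−(a·y))) = (a ⊞ b) ∩ ((x·b) ⊞ (−(a·y))). -/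

import Mathlib

open Set

namespace PaperSHF

/-- A skew hyperfield: `F ∖ {0}` is a group under `mul`, `0` is multiplicatively
absorbing, and `add` is a commutative associative hyperaddition with neutral
element `0`, hyperinverses, reversibility, and two-sided distributivity. -/
structure SkewHyperfield (F : Type*) where
  zero : F
  one : F
  mul : F → F → F
  inv : F → F
  neg : F → F
  add : F → F → Set F
  zero_ne_one : zero ≠ one
  mul_assoc : ∀ a b c, mul (mul a b) c = mul a (mul b c)
  one_mul : ∀ a, mul one a = a
  mul_one : ∀ a, mul a one = a
  mul_ne_zero : ∀ a b, a ≠ zero → b ≠ zero → mul a b ≠ zero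
  inv_ne_zero : ∀ a, a ≠ zero → inv a ≠ zero
  mul_inv_cancel : ∀ a, a ≠ zero → mul a (inv a) = one
  inv_mul_cancel : ∀ a, a ≠ zero → mul (inv a) a = one
  zero_mul : ∀ a, mul zero a = zero
  mul_zero : ∀ a, mul a zero = zero
  add_nonempty : ∀ a b, (add a b).Nonempty
  add_comm : ∀ a b, add a b = add b a
  add_assoc : ∀ a b c, (⋃ t ∈ add b c, add a t) = (⋃ s ∈ add a b, add s c)
  zero_add : ∀ a, add zero a = {a}
  add_neg_self : ∀ a, zero ∈ add a (neg a)
  neg_unique : ∀ a b, zero ∈ add a b → b = neg a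
  reversibility : ∀ x y z, x ∈ add y z ↔ z ∈ add x (neg y)
  left_distrib : ∀ a x y, add (mul a x) (mul a y) = (fun t => mul a t) '' (add x y)
  right_distrib : ∀ a x y, add (mul x a) (mul y a) = (fun t => mul t a) '' (add x y)

/-- The hyperaddition extended to subsets: `A ⊞ B = ⋃_{a ∈ A, b ∈ B} a ⊞ b`. -/
def SkewHyperfield.sadd {F : Type*} (H : SkewHyperfield F) (A B : Set F) : Set F :=
  ⋃ a ∈ A, ⋃ b ∈ B, H.add a b

/-- Strong Pathetic Cancellation. -/
def StrongPatheticCancellation {F : Type*} (H : SkewHyperfield F) : Prop :=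
  ∀ a b x y : F, a ≠ H.zero → b ≠ H.zero → x ≠ H.zero → y ≠ H.zero →
    x ∈ H.add H.one a → y ∈ H.add (H.neg H.one) b →
    H.add x y ∩ H.add a b ⊆ H.add (H.mul x b) (H.neg (H.mul a y))

/-- Pathetic Cancellation. -/
def PatheticCancellation {F : Type*} (H : SkewHyperfield F) : Prop :=
  ∀ a b x y z : F, a ≠ H.zero → b ≠ H.zero → x ≠ H.zero → y ≠ H.zero → z ≠ H.zero →
    x ∈ H.add H.one a → H.mul a x = H.mul x a →
    y ∈ H.add (H.neg H.one) b → H.mul b y = H.mul y b →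
    z ∈ H.add a b →
    H.mul (H.mul (H.inv a) z) (H.inv b) = H.mul (H.mul (H.inv b) z) (H.inv a) →
    z ∈ H.add x y →
    H.mul (H.mul (H.inv x) z) (H.inv y) = H.mul (H.mul (H.inv y) z) (H.inv x) →
    z ∈ H.add (H.mul x b) (H.neg (H.mul a y))

namespace SkewHyperfield

variable {F : Type*} (H : SkewHyperfield F)

theorem neg_neg (a : F) : H.neg (H.neg a) = a :=
  (H.neg_unique _ _ (H.add_comm a (H.neg a) ▸ H.add_neg_self a)).symm

theorem neg_zero : H.neg H.zero = H.zero :=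
  (H.neg_unique _ _ (by rw [H.zero_add]; exact mem_singleton _)).symm

theorem neg_ne_zero {a : F} (ha : a ≠ H.zero) : H.neg a ≠ H.zero := fun h =>
  ha (by rw [← H.neg_neg a, h, H.neg_zero])

theorem add_zero (a : F) : H.add a H.zero = {a} := by
  rw [H.add_comm, H.zero_add]

theorem mul_mem_add_left (c : F) {x y z : F} (h : z ∈ H.add x y) :
    H.mul c z ∈ H.add (H.mul c x) (H.mul c y) := by
  rw [H.left_distrib]
  exact mem_image_of_mem _ h

theorem mul_mem_add_right (c : F) {x y z : F} (h : z ∈ H.add x y) :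
    H.mul z c ∈ H.add (H.mul x c) (H.mul y c) := by
  rw [H.right_distrib]
  exact mem_image_of_mem (fun t => H.mul t c) h

theorem neg_mul (a b : F) : H.mul (H.neg a) b = H.neg (H.mul a b) :=
  H.neg_unique _ _ (by simpa only [H.zero_mul] using H.mul_mem_add_right b (H.add_neg_self a))

theorem mul_neg (a b : F) : H.mul a (H.neg b) = H.neg (H.mul a b) :=
  H.neg_unique _ _ (by simpa only [H.mul_zero] using H.mul_mem_add_left a (H.add_neg_self b))

theorem neg_mem_add {x y z : F} (h : z ∈ H.add x y) :
    H.neg z ∈ H.add (H.neg x) (H.neg y) := by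
  simpa only [H.neg_mul, H.one_mul] using H.mul_mem_add_left (H.neg H.one) h

theorem inv_mul_cancel_left {a : F} (ha : a ≠ H.zero) (b : F) :
    H.mul (H.inv a) (H.mul a b) = b := by
  rw [← H.mul_assoc, H.inv_mul_cancel a ha, H.one_mul]

theorem mul_inv_cancel_left {a : F} (ha : a ≠ H.zero) (b : F) :
    H.mul a (H.mul (H.inv a) b) = b := by
  rw [← H.mul_assoc, H.mul_inv_cancel a ha, H.one_mul]

/-- Membership in a hypersum can be checked after multiplying by units on both sides. -/
theorem mem_add_of_mul_inv_mem {c d x y z : F} (hc : c ≠ H.zero) (hd : d ≠ H.zero)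
    (h : H.mul (H.inv c) (H.mul z (H.inv d)) ∈
      H.add (H.mul (H.inv c) (H.mul x (H.inv d))) (H.mul (H.inv c) (H.mul y (H.inv d)))) :
    z ∈ H.add x y := by
  simpa only [H.mul_inv_cancel_left hc, H.mul_assoc, H.inv_mul_cancel d hd, H.mul_one] using
    H.mul_mem_add_right d (H.mul_mem_add_left c h)

theorem mul_inv_mem_add (c d : F) {x y z : F} (h : z ∈ H.add x y) :
    H.mul (H.inv c) (H.mul z (H.inv d)) ∈
      H.add (H.mul (H.inv c) (H.mul x (H.inv d))) (H.mul (H.inv c) (H.mul y (H.inv d))) :=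
  H.mul_mem_add_left _ (H.mul_mem_add_right _ h)

theorem mem_add_neg_of_mem_add {x y z : F} (h : x ∈ H.add y z) : z ∈ H.add x (H.neg y) :=
  (H.reversibility x y z).1 h

end SkewHyperfield

namespace StrongPatheticCancellation

variable {F : Type*} {H : SkewHyperfield F} {a b x y : F}

/-- Strong Pathetic Cancellation applied to `a⁻¹, b⁻¹, a⁻¹x, -(yb⁻¹)`. -/
theorem inter_subset_add (h : StrongPatheticCancellation H)
    (ha : a ≠ H.zero) (hb : b ≠ H.zero) (hx : x ≠ H.zero) (hy : y ≠ H.zero)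
    (hxa : x ∈ H.add H.one a) (hyb : y ∈ H.add (H.neg H.one) b) :
    H.add a b ∩ H.add (H.mul x b) (H.neg (H.mul a y)) ⊆ H.add x y := by
  rintro z ⟨hz, hz'⟩
  have hx' : H.mul (H.inv a) x ∈ H.add H.one (H.inv a) := by
    have := H.mul_mem_add_left (H.inv a) hxa
    rwa [H.mul_one, H.inv_mul_cancel a ha, H.add_comm] at this
  have hy' : H.neg (H.mul y (H.inv b)) ∈ H.add (H.neg H.one) (H.inv b) := by
    have := H.neg_mem_add (H.mul_mem_add_right (H.inv b) hyb)
    rwa [H.neg_mul, H.one_mul, H.neg_neg, H.mul_inv_cancel b hb, H.add_comm] at this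
  have hza := H.mul_inv_mem_add a b hz
  rw [H.mul_inv_cancel b hb, H.mul_one, H.inv_mul_cancel_left ha, H.add_comm] at hza
  have hzx := H.mul_inv_mem_add a b hz'
  simp only [H.neg_mul, H.mul_neg, H.mul_assoc, H.mul_inv_cancel b hb, H.mul_one,
    H.inv_mul_cancel_left ha] at hzx
  have key := h _ _ _ _ (H.inv_ne_zero a ha) (H.inv_ne_zero b hb)
    (H.mul_ne_zero _ _ (H.inv_ne_zero a ha) hx)
    (H.neg_ne_zero (H.mul_ne_zero _ _ hy (H.inv_ne_zero b hb))) hx' hy'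
    ⟨hzx, hza⟩
  simp only [H.mul_neg, H.neg_neg, H.mul_assoc] at key
  exact H.mem_add_of_mul_inv_mem ha hb key

/-- Strong Pathetic Cancellation applied to `-x⁻¹, -y⁻¹, x⁻¹a, -(by⁻¹)`. -/
theorem inter_subset_add' (h : StrongPatheticCancellation H)
    (ha : a ≠ H.zero) (hb : b ≠ H.zero) (hx : x ≠ H.zero) (hy : y ≠ H.zero)
    (hxa : x ∈ H.add H.one a) (hyb : y ∈ H.add (H.neg H.one) b) :
    H.add x y ∩ H.add (H.mul x b) (H.neg (H.mul a y)) ⊆ H.add a b := by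
  rintro z ⟨hz, hz'⟩
  have hx' : H.mul (H.inv x) a ∈ H.add H.one (H.neg (H.inv x)) := by
    have := H.mul_mem_add_left (H.inv x) (H.mem_add_neg_of_mem_add hxa)
    rwa [H.mul_neg, H.mul_one, H.inv_mul_cancel x hx] at this
  have hy' : H.neg (H.mul b (H.inv y)) ∈ H.add (H.neg H.one) (H.neg (H.inv y)) := by
    have := H.neg_mem_add (H.mul_mem_add_right (H.inv y) (H.mem_add_neg_of_mem_add hyb))
    rwa [H.neg_neg, H.one_mul, H.mul_inv_cancel y hy] at this
  have hza := H.neg_mem_add (H.mul_inv_mem_add x y hz)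
  rw [H.mul_inv_cancel y hy, H.mul_one, H.inv_mul_cancel_left hx, H.add_comm] at hza
  have hzx := H.neg_mem_add (H.mul_inv_mem_add x y hz')
  simp only [H.neg_mul, H.mul_neg, H.neg_neg, H.mul_assoc, H.mul_inv_cancel y hy, H.mul_one,
    H.inv_mul_cancel_left hx] at hzx
  rw [H.add_comm] at hzx
  have key := h _ _ _ _ (H.neg_ne_zero (H.inv_ne_zero x hx))
    (H.neg_ne_zero (H.inv_ne_zero y hy))
    (H.mul_ne_zero _ _ (H.inv_ne_zero x hx) ha)
    (H.neg_ne_zero (H.mul_ne_zero _ _ hb (H.inv_ne_zero y hy))) hx' hy' ⟨hzx, hza⟩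
  replace key := H.neg_mem_add key
  simp only [H.mul_neg, H.neg_mul, H.neg_neg, H.mul_assoc] at key
  exact H.mem_add_of_mul_inv_mem hx hy key

theorem inclusions (h : StrongPatheticCancellation H) (ha : a ≠ H.zero) (hb : b ≠ H.zero)
    (hxa : x ∈ H.add H.one a) (hyb : y ∈ H.add (H.neg H.one) b) :
    (H.add x y ∩ H.add a b ⊆ H.add (H.mul x b) (H.neg (H.mul a y))) ∧
    (H.add a b ∩ H.add (H.mul x b) (H.neg (H.mul a y)) ⊆ H.add x y) ∧
    (H.add x y ∩ H.add (H.mul x b) (H.neg (H.mul a y)) ⊆ H.add a b) := by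
  by_cases hx : x = H.zero
  · subst hx
    obtain rfl := H.neg_unique _ _ hxa
    simp only [H.zero_mul, H.neg_mul, H.neg_neg, H.one_mul, H.zero_add]
    exact ⟨inter_subset_left, inter_subset_right, by simpa using hyb⟩
  by_cases hy : y = H.zero
  · subst hy
    obtain rfl := (H.neg_unique _ _ hyb).trans (H.neg_neg _)
    simp only [H.mul_zero, H.mul_one, H.neg_zero, H.add_zero]
    exact ⟨inter_subset_left, inter_subset_right, by simpa [H.add_comm] using hxa⟩
  exact ⟨h a b x y ha hb hx hy hxa hyb, h.inter_subset_add ha hb hx hy hxa hyb,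
    h.inter_subset_add' ha hb hx hy hxa hyb⟩

end StrongPatheticCancellation

/-- characterizations of strong Pathetic Cancellation. -/
theorem strongPC_tfae {F : Type*} (H : SkewHyperfield F) :
    (StrongPatheticCancellation H ↔
      ∀ a b x y : F, a ≠ H.zero → b ≠ H.zero →
        x ∈ H.add H.one a → y ∈ H.add (H.neg H.one) b →
        (H.add x y ∩ H.add a b ⊆ H.add (H.mul x b) (H.neg (H.mul a y))) ∧
        (H.add a b ∩ H.add (H.mul x b) (H.neg (H.mul a y)) ⊆ H.add x y) ∧
        (H.add x y ∩ H.add (H.mul x b) (H.neg (H.mul a y)) ⊆ H.add a b)) ∧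
    (StrongPatheticCancellation H ↔
      ∀ a b x y : F, a ≠ H.zero → b ≠ H.zero →
        x ∈ H.add H.one a → y ∈ H.add (H.neg H.one) b →
        (H.add x y ∩ H.add a b
            = H.add x y ∩ H.add (H.mul x b) (H.neg (H.mul a y))) ∧
        (H.add x y ∩ H.add (H.mul x b) (H.neg (H.mul a y))
            = H.add a b ∩ H.add (H.mul x b) (H.neg (H.mul a y)))) := by
  refine ⟨⟨fun h a b x y ha hb hx hy => h.inclusions ha hb hx hy,
    fun h a b x y ha hb _ _ hxa hyb => (h a b x y ha hb hxa hyb).1⟩,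
    ⟨fun h a b x y ha hb hx hy => ?_, fun h a b x y ha hb _ _ hxa hyb => ?_⟩⟩
  · obtain ⟨h₁, h₂, h₃⟩ := h.inclusions ha hb hx hy
    exact ⟨Subset.antisymm (fun _ hz => ⟨hz.1, h₁ hz⟩) fun _ hz => ⟨hz.1, h₃ hz⟩,
      Subset.antisymm (fun _ hz => ⟨h₃ hz, hz.2⟩) fun _ hz => ⟨h₂ hz, hz.2⟩⟩
  · rw [(h a b x y ha hb hxa hyb).1]
    exact inter_subset_right

end PaperSHF
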